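/- For each n ∈ ℕ, the theories WR(Σ_{n+1} ∧ Π_{n+1}) and IΣ_{n+2} are equivalent: a model of IΔ0 satisfies the weak regularity principle for all conjunctions of a Σ_{n+1} and a Π_{n+1} formula if and only if it satisfies Σ_{n+2}-induction. -/

import Mathlib

namespace PaperArith

/-! ## Syntax of (two-sorted) first-order arithmetic

Terms and formulas of arithmetic in the language `{0, 1, +, ·, <}`,
with number variables and (monadic second-order) set variables both indexed
by natural numbers.  Bounded quantifiers are taken as primitives, so that the
class `Δ₀` of bounded formulas is a purely syntactic class. -/

/-- Terms of first-order arithmetic in the language `{0, 1, +, ·, <}`. -/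
inductive Term : Type
  | var : ℕ → Term
  | zero : Term
  | one : Term
  | add : Term → Term → Term
  | mul : Term → Term → Term

/-- Formulas of (two-sorted) arithmetic.  `mem t i` is the atomic formula
`t ∈ Xᵢ`; `ball x t φ` is `∀ x < t, φ` and `bex x t φ` is `∃ x < t, φ`;
`sall i φ` and `sex i φ` quantify over the set variable `Xᵢ`.
Purely first-order formulas are those avoiding `mem`, `sall`, `sex`. -/
inductive Fml : Type
  | eq : Term → Term → Fml
  | lt : Term → Term → Fml
  | mem : Term → ℕ → Fml
  | not : Fml → Fml
  | and : Fml → Fml → Fml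
  | or : Fml → Fml → Fml
  | imp : Fml → Fml → Fml
  | all : ℕ → Fml → Fml
  | ex : ℕ → Fml → Fml
  | ball : ℕ → Term → Fml → Fml
  | bex : ℕ → Term → Fml → Fml
  | sall : ℕ → Fml → Fml
  | sex : ℕ → Fml → Fml

/-- A structure for the first-order language of arithmetic. -/
structure Str : Type 1 where
  M : Type
  zero : M
  one : M
  add : M → M → M
  mul : M → M → M
  lt : M → M → Prop

/-- Value of a term under a valuation of the number variables. -/
def tval (S : Str) (v : ℕ → S.M) : Term → S.M
  | .var i => v i
  | .zero => S.zero
  | .one => S.one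
  | .add t u => S.add (tval S v t) (tval S v u)
  | .mul t u => S.mul (tval S v t) (tval S v u)

/-- Update a valuation at one variable. -/
def upd {α : Type} (v : ℕ → α) (x : ℕ) (a : α) : ℕ → α :=
  fun i => if i = x then a else v i

/-- Tarskian satisfaction over the structure `S`, with second-order universe
`X` (set quantifiers range over `X`); `v` is the valuation of number
variables, `w` the valuation of set variables. -/
def Sat (S : Str) (X : Set (Set S.M)) : (ℕ → S.M) → (ℕ → Set S.M) → Fml → Prop
  | v, _, .eq t u => tval S v t = tval S v u
  | v, _, .lt t u => S.lt (tval S v t) (tval S v u)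
  | v, w, .mem t i => tval S v t ∈ w i
  | v, w, .not φ => ¬ Sat S X v w φ
  | v, w, .and φ ψ => Sat S X v w φ ∧ Sat S X v w ψ
  | v, w, .or φ ψ => Sat S X v w φ ∨ Sat S X v w ψ
  | v, w, .imp φ ψ => Sat S X v w φ → Sat S X v w ψ
  | v, w, .all x φ => ∀ m : S.M, Sat S X (upd v x m) w φ
  | v, w, .ex x φ => ∃ m : S.M, Sat S X (upd v x m) w φ
  | v, w, .ball x t φ => ∀ m : S.M, S.lt m (tval S v t) → Sat S X (upd v x m) w φ
  | v, w, .bex x t φ => ∃ m : S.M, S.lt m (tval S v t) ∧ Sat S X (upd v x m) w φ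
  | v, w, .sall i φ => ∀ A : Set S.M, A ∈ X → Sat S X v (upd w i A) φ
  | v, w, .sex i φ => ∃ A : Set S.M, A ∈ X ∧ Sat S X v (upd w i A) φ

/-- First-order satisfaction (for purely first-order formulas the second-order
data is irrelevant). -/
def Sat0 (S : Str) (v : ℕ → S.M) (φ : Fml) : Prop :=
  Sat S ∅ v (fun _ => ∅) φ

/-! ## The arithmetic hierarchy -/

/-- `Δ₀` formulas: purely first-order, only bounded quantifiers. -/
inductive Delta0 : Fml → Prop
  | eq (t u : Term) : Delta0 (.eq t u)
  | lt (t u : Term) : Delta0 (.lt t u)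
  | not {φ : Fml} : Delta0 φ → Delta0 (.not φ)
  | and {φ ψ : Fml} : Delta0 φ → Delta0 ψ → Delta0 (.and φ ψ)
  | or {φ ψ : Fml} : Delta0 φ → Delta0 ψ → Delta0 (.or φ ψ)
  | imp {φ ψ : Fml} : Delta0 φ → Delta0 ψ → Delta0 (.imp φ ψ)
  | ball (x : ℕ) (t : Term) {φ : Fml} : Delta0 φ → Delta0 (.ball x t φ)
  | bex (x : ℕ) (t : Term) {φ : Fml} : Delta0 φ → Delta0 (.bex x t φ)

mutual
  /-- `Σₙ` formulas of the first-order arithmetic hierarchy. -/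
  inductive IsSigma : ℕ → Fml → Prop
    | delta0 {n : ℕ} {φ : Fml} : Delta0 φ → IsSigma n φ
    | ofPi {n : ℕ} {φ : Fml} : IsPi n φ → IsSigma (n + 1) φ
    | ex (x : ℕ) {n : ℕ} {φ : Fml} : IsSigma (n + 1) φ → IsSigma (n + 1) (.ex x φ)
  /-- `Πₙ` formulas of the first-order arithmetic hierarchy. -/
  inductive IsPi : ℕ → Fml → Prop
    | delta0 {n : ℕ} {φ : Fml} : Delta0 φ → IsPi n φ
    | ofSigma {n : ℕ} {φ : Fml} : IsSigma n φ → IsPi (n + 1) φ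
    | all (x : ℕ) {n : ℕ} {φ : Fml} : IsPi (n + 1) φ → IsPi (n + 1) (.all x φ)
end

/-- `Σ₀(Σₙ)`: the closure of `Σₙ` under Boolean operations and bounded
quantification. -/
inductive Sigma0Sigma (n : ℕ) : Fml → Prop
  | ofSigma {φ : Fml} : IsSigma n φ → Sigma0Sigma n φ
  | not {φ : Fml} : Sigma0Sigma n φ → Sigma0Sigma n (.not φ)
  | and {φ ψ : Fml} : Sigma0Sigma n φ → Sigma0Sigma n ψ → Sigma0Sigma n (.and φ ψ)
  | or {φ ψ : Fml} : Sigma0Sigma n φ → Sigma0Sigma n ψ → Sigma0Sigma n (.or φ ψ)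
  | imp {φ ψ : Fml} : Sigma0Sigma n φ → Sigma0Sigma n ψ → Sigma0Sigma n (.imp φ ψ)
  | ball (x : ℕ) (t : Term) {φ : Fml} : Sigma0Sigma n φ → Sigma0Sigma n (.ball x t φ)
  | bex (x : ℕ) (t : Term) {φ : Fml} : Sigma0Sigma n φ → Sigma0Sigma n (.bex x t φ)

/-- The class `Σₙ ∧ Πₙ` of conjunctions of a `Σₙ` and a `Πₙ` formula. -/
def SigmaAndPi (n : ℕ) (φ : Fml) : Prop :=
  ∃ ψ χ : Fml, IsSigma n ψ ∧ IsPi n χ ∧ φ = Fml.and ψ χ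

/-- The class `Σₙ ∨ Πₙ` of disjunctions of a `Σₙ` and a `Πₙ` formula. -/
def SigmaOrPi (n : ℕ) (φ : Fml) : Prop :=
  ∃ ψ χ : Fml, IsSigma n ψ ∧ IsPi n χ ∧ φ = Fml.or ψ χ

/-- `Δ₀⁰` formulas of second-order arithmetic: only bounded first-order
quantifiers; free set variables (set parameters) are allowed. -/
inductive Delta0SO : Fml → Prop
  | eq (t u : Term) : Delta0SO (.eq t u)
  | lt (t u : Term) : Delta0SO (.lt t u)
  | mem (t : Term) (i : ℕ) : Delta0SO (.mem t i)
  | not {φ : Fml} : Delta0SO φ → Delta0SO (.not φ)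
  | and {φ ψ : Fml} : Delta0SO φ → Delta0SO ψ → Delta0SO (.and φ ψ)
  | or {φ ψ : Fml} : Delta0SO φ → Delta0SO ψ → Delta0SO (.or φ ψ)
  | imp {φ ψ : Fml} : Delta0SO φ → Delta0SO ψ → Delta0SO (.imp φ ψ)
  | ball (x : ℕ) (t : Term) {φ : Fml} : Delta0SO φ → Delta0SO (.ball x t φ)
  | bex (x : ℕ) (t : Term) {φ : Fml} : Delta0SO φ → Delta0SO (.bex x t φ)

mutual
  /-- `Σₙ⁰` formulas of the second-order arithmetic hierarchy
  (set parameters allowed, no set quantifiers). -/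
  inductive SigmaSO : ℕ → Fml → Prop
    | delta0 {n : ℕ} {φ : Fml} : Delta0SO φ → SigmaSO n φ
    | ofPi {n : ℕ} {φ : Fml} : PiSO n φ → SigmaSO (n + 1) φ
    | ex (x : ℕ) {n : ℕ} {φ : Fml} : SigmaSO (n + 1) φ → SigmaSO (n + 1) (.ex x φ)
  /-- `Πₙ⁰` formulas of the second-order arithmetic hierarchy. -/
  inductive PiSO : ℕ → Fml → Prop
    | delta0 {n : ℕ} {φ : Fml} : Delta0SO φ → PiSO n φ
    | ofSigma {n : ℕ} {φ : Fml} : SigmaSO n φ → PiSO (n + 1) φ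
    | all (x : ℕ) {n : ℕ} {φ : Fml} : PiSO (n + 1) φ → PiSO (n + 1) (.all x φ)
end

/-! ## First-order theories -/

/-- `PA⁻`: the theory of non-negative parts of discretely ordered rings. -/
structure PAminus (S : Str) : Prop where
  add_assoc : ∀ a b c, S.add (S.add a b) c = S.add a (S.add b c)
  add_comm : ∀ a b, S.add a b = S.add b a
  mul_assoc : ∀ a b c, S.mul (S.mul a b) c = S.mul a (S.mul b c)
  mul_comm : ∀ a b, S.mul a b = S.mul b a
  distrib : ∀ a b c, S.mul a (S.add b c) = S.add (S.mul a b) (S.mul a c)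
  add_zero : ∀ a, S.add a S.zero = a
  mul_zero : ∀ a, S.mul a S.zero = S.zero
  mul_one : ∀ a, S.mul a S.one = a
  lt_irrefl : ∀ a, ¬ S.lt a a
  lt_trans : ∀ a b c, S.lt a b → S.lt b c → S.lt a c
  lt_total : ∀ a b, S.lt a b ∨ a = b ∨ S.lt b a
  add_lt_add : ∀ a b c, S.lt a b → S.lt (S.add a c) (S.add b c)
  mul_lt_mul : ∀ a b c, S.lt a b → S.lt S.zero c → S.lt (S.mul a c) (S.mul b c)
  zero_lt_one : S.lt S.zero S.one
  zero_le : ∀ a, a = S.zero ∨ S.lt S.zero a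
  discrete : ∀ a b, S.lt a b → S.add a S.one = b ∨ S.lt (S.add a S.one) b
  pred : ∀ a, S.lt S.zero a → ∃ b, S.add b S.one = a
  sub : ∀ a b, S.lt a b → ∃ c, S.add a c = b

/-- The induction scheme for the class `Γ` of formulas
(parameters are allowed via the ambient valuation `v`). -/
def IndFor (S : Str) (Γ : Fml → Prop) : Prop :=
  ∀ φ : Fml, Γ φ → ∀ (v : ℕ → S.M) (x : ℕ),
    Sat0 S (upd v x S.zero) φ →
    (∀ m, Sat0 S (upd v x m) φ → Sat0 S (upd v x (S.add m S.one)) φ) →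
    ∀ m, Sat0 S (upd v x m) φ

/-- The collection scheme for the class `Γ`:
`(∀ x < a ∃ y φ) → (∃ b ∀ x < a ∃ y < b φ)`. -/
def CollFor (S : Str) (Γ : Fml → Prop) : Prop :=
  ∀ φ : Fml, Γ φ → ∀ (v : ℕ → S.M) (x y : ℕ), x ≠ y → ∀ a : S.M,
    (∀ m, S.lt m a → ∃ k, Sat0 S (upd (upd v x m) y k) φ) →
    ∃ b, ∀ m, S.lt m a → ∃ k, S.lt k b ∧ Sat0 S (upd (upd v x m) y k) φ

/-- `IΔ₀` (over `PA⁻`). -/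
def IDelta0 (S : Str) : Prop := PAminus S ∧ IndFor S Delta0

/-- `IΣₙ` (over `PA⁻`; note `Δ₀ ⊆ Σₙ`, so this includes `IΔ₀`). -/
def ISigma (S : Str) (n : ℕ) : Prop := PAminus S ∧ IndFor S (IsSigma n)

/-- `BΣₙ`: the `Σₙ`-collection scheme, including `IΔ₀` (over `PA⁻`). -/
def BSigma (S : Str) (n : ℕ) : Prop := IDelta0 S ∧ CollFor S (IsSigma n)

/-- The weak regularity principle `WRφ` for all `φ` in the class `Γ`:
the universal closure of `(∀ x ∃ y < a φ(x,y)) → (∃ y < a ∀ b ∃ x > b φ(x,y))`.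
Here `x, y` are the two displayed variables and all other free variables of
`φ` are parameters, interpreted by the ambient valuation `v`. -/
def WRFor (S : Str) (Γ : Fml → Prop) : Prop :=
  ∀ φ : Fml, Γ φ → ∀ (v : ℕ → S.M) (x y : ℕ), x ≠ y → ∀ a : S.M,
    (∀ m, ∃ k, S.lt k a ∧ Sat0 S (upd (upd v x m) y k) φ) →
    ∃ k, S.lt k a ∧ ∀ b, ∃ m, S.lt b m ∧ Sat0 S (upd (upd v x m) y k) φ

/-! ## Second-order theories -/

/-- Second-order induction scheme for the class `Γ`, with set parameters
from the second-order universe `X`. -/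
def IndForSO (S : Str) (X : Set (Set S.M)) (Γ : Fml → Prop) : Prop :=
  ∀ φ : Fml, Γ φ → ∀ (v : ℕ → S.M) (w : ℕ → Set S.M), (∀ i, w i ∈ X) → ∀ x : ℕ,
    Sat S X (upd v x S.zero) w φ →
    (∀ m, Sat S X (upd v x m) w φ → Sat S X (upd v x (S.add m S.one)) w φ) →
    ∀ m, Sat S X (upd v x m) w φ

/-- Second-order collection scheme for the class `Γ`. -/
def CollForSO (S : Str) (X : Set (Set S.M)) (Γ : Fml → Prop) : Prop :=
  ∀ φ : Fml, Γ φ → ∀ (v : ℕ → S.M) (w : ℕ → Set S.M), (∀ i, w i ∈ X) →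
    ∀ (x y : ℕ), x ≠ y → ∀ a : S.M,
    (∀ m, S.lt m a → ∃ k, Sat S X (upd (upd v x m) y k) w φ) →
    ∃ b, ∀ m, S.lt m a → ∃ k, S.lt k b ∧ Sat S X (upd (upd v x m) y k) w φ

/-- `Δ₁⁰`-comprehension. -/
def Delta1CA (S : Str) (X : Set (Set S.M)) : Prop :=
  ∀ φ ψ : Fml, SigmaSO 1 φ → PiSO 1 ψ →
    ∀ (v : ℕ → S.M) (w : ℕ → Set S.M), (∀ i, w i ∈ X) → ∀ x : ℕ,
    (∀ m, Sat S X (upd v x m) w φ ↔ Sat S X (upd v x m) w ψ) →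
    ∃ A ∈ X, ∀ m, m ∈ A ↔ Sat S X (upd v x m) w φ

/-- `Σₙ`-comprehension for first-order formulas with parameters from `M`. -/
def SigmaCA (S : Str) (X : Set (Set S.M)) (n : ℕ) : Prop :=
  ∀ φ : Fml, IsSigma n φ → ∀ (v : ℕ → S.M) (x : ℕ),
    ∃ A ∈ X, ∀ m, m ∈ A ↔ Sat0 S (upd v x m) φ

/-- `RCA₀`. -/
def RCA0 (S : Str) (X : Set (Set S.M)) : Prop :=
  PAminus S ∧ IndForSO S X (SigmaSO 1) ∧ Delta1CA S X

/-- `Σ₁⁰`-separation; over `RCA₀` this is equivalent to weak Kőnig's lemma. -/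
def Sigma1Sep (S : Str) (X : Set (Set S.M)) : Prop :=
  ∀ φ ψ : Fml, SigmaSO 1 φ → SigmaSO 1 ψ →
    ∀ (v : ℕ → S.M) (w : ℕ → Set S.M), (∀ i, w i ∈ X) → ∀ x : ℕ,
    (∀ m, ¬ (Sat S X (upd v x m) w φ ∧ Sat S X (upd v x m) w ψ)) →
    ∃ A ∈ X, ∀ m, (Sat S X (upd v x m) w φ → m ∈ A) ∧ (m ∈ A → ¬ Sat S X (upd v x m) w ψ)

/-- `WKL₀`, rendered as `RCA₀` plus `Σ₁⁰`-separation (which is equivalent,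
over `RCA₀`, to weak Kőnig's lemma). -/
def WKL0 (S : Str) (X : Set (Set S.M)) : Prop := RCA0 S X ∧ Sigma1Sep S X

/-- `BΣₙ⁰`: the second-order `Σₙ⁰`-collection scheme (including `IΔ₀⁰`,
over `PA⁻`). -/
def BSigmaSO (S : Str) (X : Set (Set S.M)) (n : ℕ) : Prop :=
  PAminus S ∧ IndForSO S X Delta0SO ∧ CollForSO S X (SigmaSO n)

/-- `IΣₙ⁰`: the second-order `Σₙ⁰`-induction scheme, over `RCA₀`. -/
def ISigmaSO (S : Str) (X : Set (Set S.M)) (n : ℕ) : Prop :=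
  RCA0 S X ∧ IndForSO S X (SigmaSO n)

/-! ## Exponentiation and binary digits -/

/-- Satisfaction of a three-variable formula `E(x₀, x₁, x₂)` at `(a, b, c)`. -/
def ExpAt (S : Str) (E : Fml) (a b c : S.M) : Prop :=
  Sat0 S (fun i => if i = 0 then a else if i = 1 then b else c) E

/-- `E(x₀,x₁,x₂)` is a `Δ₀` definition of the (total) exponentiation function
`x₀ ^ x₁ = x₂`.  The existence of such an `E` expresses `exp`
(the totality of exponentiation). -/
structure IsExpDef (S : Str) (E : Fml) : Prop where
  delta0 : Delta0 E
  base : ∀ a, ExpAt S E a S.zero S.one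
  total : ∀ a b, ∃ c, ExpAt S E a b c
  unique : ∀ a b c c', ExpAt S E a b c → ExpAt S E a b c' → c = c'
  step : ∀ a b c, ExpAt S E a b c → ExpAt S E a (S.add b S.one) (S.mul c a)

/-- `exp`: the totality of exponentiation (via a `Δ₀` definition of its
graph). -/
def SatExp (S : Str) : Prop := ∃ E : Fml, IsExpDef S E

/-! ## Embeddings, end extensions and elementarity -/

/-- An embedding of arithmetic structures. -/
structure Emb (S K : Str) where
  j : S.M → K.M
  inj : Function.Injective j
  zero : j S.zero = K.zero
  one : j S.one = K.one
  add : ∀ a b, j (S.add a b) = K.add (j a) (j b)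
  mul : ∀ a b, j (S.mul a b) = K.mul (j a) (j b)
  lt_iff : ∀ a b, S.lt a b ↔ K.lt (j a) (j b)

/-- The extension along `e` is an end extension: every element of `K` not in
the image of `M` exceeds every element of `M`. -/
def IsEndExt {S K : Str} (e : Emb S K) : Prop :=
  ∀ b : K.M, b ∉ Set.range e.j → ∀ a : S.M, K.lt (e.j a) b

/-- The extension along `e` is proper. -/
def IsProper {S K : Str} (e : Emb S K) : Prop := ¬ Function.Surjective e.j

/-- The extension along `e` is `Σₙ`-elementary: all `Σₙ` formulas with
parameters from `M` are absolute between `M` and `K`. -/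
def SigmaElem {S K : Str} (e : Emb S K) (n : ℕ) : Prop :=
  ∀ φ : Fml, IsSigma n φ → ∀ v : ℕ → S.M,
    (Sat0 S v φ ↔ Sat0 K (fun i => e.j (v i)) φ)

/-- `K ⊨ M‑IΣₙ` (for an extension `e : M → K`): induction up to any `a ∈ M`
for `Σₙ` formulas with parameters from `K`. -/
def MISigma {S K : Str} (e : Emb S K) (n : ℕ) : Prop :=
  ∀ φ : Fml, IsSigma n φ → ∀ (v : ℕ → K.M) (x : ℕ) (a : S.M),
    Sat0 K (upd v x K.zero) φ →
    (∀ m, K.lt m (e.j a) → (Sat0 K (upd v x m) φ → Sat0 K (upd v x (K.add m K.one)) φ)) →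
    ∀ m, K.lt m (e.j a) → Sat0 K (upd v x m) φ

/-- The `x`-th binary digit of `c ∈ K` is `1`, computed via a `Δ₀` definition
`E` of exponentiation on the ground model `S` (here `x` lies under the image
of `S`): there are `x', p ∈ M` with `j x' = x`, `p = 2 ^ x'`, and `u, v ∈ K`
with `c = u·(2p) + p + v` and `v < p`. -/
def BitVia {S K : Str} (e : Emb S K) (E : Fml) (x c : K.M) : Prop :=
  ∃ x' p : S.M, e.j x' = x ∧ ExpAt S E (S.add S.one S.one) x' p ∧
    ∃ u v : K.M, K.lt v (e.j p) ∧
      c = K.add (K.add (K.mul u (K.add (e.j p) (e.j p))) (e.j p)) v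

/-! ## The second-order restricted ultrapower -/

/-- `A` is cofinal (unbounded) in `S`. -/
def Cofinal (S : Str) (A : Set S.M) : Prop := ∀ b : S.M, ∃ x ∈ A, S.lt b x

/-- The pairing term `⟨x, y⟩ = (x + y)·(x + y) + x`. -/
def pairS (S : Str) (x y : S.M) : S.M := S.add (S.mul (S.add x y) (S.add x y)) x

/-- The graph of `f : M → M`, coded as a subset of `M` via pairing. -/
def graphOf (S : Str) (f : S.M → S.M) : Set S.M := {m | ∃ x, m = pairS S x (f x)}

/-- `f` is a total function `M → M` lying in the second-order universe `X`
(its coded graph belongs to `X`).  The collection of such `f` is the class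
`ℱ` of the restricted ultrapower. -/
def FuncIn (S : Str) (X : Set (Set S.M)) (f : S.M → S.M) : Prop := graphOf S f ∈ X

/-- `U` is an ultrafilter on the Boolean algebra `X`, all of whose elements
are cofinal in `M`. -/
structure UltraOn (S : Str) (X U : Set (Set S.M)) : Prop where
  subset : U ⊆ X
  univ_mem : Set.univ ∈ U
  empty_not_mem : ∅ ∉ U
  inter_mem : ∀ A ∈ U, ∀ B ∈ U, A ∩ B ∈ U
  superset_mem : ∀ A ∈ U, ∀ B ∈ X, A ⊆ B → B ∈ U
  ultra : ∀ A ∈ X, A ∈ U ∨ Aᶜ ∈ U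
  cofinal : ∀ A ∈ U, Cofinal S A

/-- A realization of the second-order restricted ultrapower `ℱ/𝒰` of `S`
with respect to the second-order universe `X` and the ultrafilter `U`:
a structure `K` whose elements are exactly the classes `cls f hf = [f]` of
total functions `f ∈ ℱ`, where `[f] = [g]` iff `f = g` on a set in `U`, with
pointwise arithmetic operations, order decided by `U`, and the inherited
second-order membership relation `memK` serving as the second-order expansion. -/
structure RUP (S : Str) (X U : Set (Set S.M)) : Type 1 where
  K : Str
  cls : (f : S.M → S.M) → FuncIn S X f → K.M
  memK : K.M → Set S.M → Prop
  const_in : ∀ a : S.M, FuncIn S X (fun _ => a)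
  surj : ∀ b : K.M, ∃ (f : S.M → S.M) (hf : FuncIn S X f), cls f hf = b
  eq_iff : ∀ (f : S.M → S.M) (hf : FuncIn S X f) (g : S.M → S.M) (hg : FuncIn S X g),
      (cls f hf = cls g hg) ↔ {i : S.M | f i = g i} ∈ U
  lt_iff : ∀ (f : S.M → S.M) (hf : FuncIn S X f) (g : S.M → S.M) (hg : FuncIn S X g),
      K.lt (cls f hf) (cls g hg) ↔ {i : S.M | S.lt (f i) (g i)} ∈ U
  zero_eq : K.zero = cls (fun _ => S.zero) (const_in S.zero)
  one_eq : K.one = cls (fun _ => S.one) (const_in S.one)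
  add_eq : ∀ (f : S.M → S.M) (hf : FuncIn S X f) (g : S.M → S.M) (hg : FuncIn S X g)
      (h : S.M → S.M) (hh : FuncIn S X h), (∀ i, h i = S.add (f i) (g i)) →
      K.add (cls f hf) (cls g hg) = cls h hh
  mul_eq : ∀ (f : S.M → S.M) (hf : FuncIn S X f) (g : S.M → S.M) (hg : FuncIn S X g)
      (h : S.M → S.M) (hh : FuncIn S X h), (∀ i, h i = S.mul (f i) (g i)) →
      K.mul (cls f hf) (cls g hg) = cls h hh
  mem_iff : ∀ (f : S.M → S.M) (hf : FuncIn S X f) (A : Set S.M), A ∈ X →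
      (memK (cls f hf) A ↔ {i : S.M | f i ∈ A} ∈ U)

/-- The canonical embedding `M → ℱ/𝒰` via constant functions. -/
def RUP.emb {S : Str} {X U : Set (Set S.M)} (R : RUP S X U) (a : S.M) : R.K.M :=
  R.cls (fun _ => a) (R.const_in a)

/-- The subset of `ℱ/𝒰` induced by `A ⊆ M`. -/
def RUP.setImg {S : Str} {X U : Set (Set S.M)} (R : RUP S X U) (A : Set S.M) :
    Set R.K.M := {b | R.memK b A}

/-- The second-order part of the expanded ultrapower `(ℱ/𝒰, 𝒳)`:
the (injected) copy of `X`. -/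
def RUP.X2 {S : Str} {X U : Set (Set S.M)} (R : RUP S X U) : Set (Set R.K.M) :=
  (fun A => R.setImg A) '' X

end PaperArith

namespace PaperArith


/-! ### Substitution in terms and formulas -/

/-- Simultaneous substitution of terms for variables in a term. -/
def Term.subst (f : ℕ → Term) : Term → Term
  | .var i => f i
  | .zero => .zero
  | .one => .one
  | .add t u => .add (t.subst f) (u.subst f)
  | .mul t u => .mul (t.subst f) (u.subst f)

/-- A strict upper bound of the variables of a term. -/
def Term.bound : Term → ℕ
  | .var i => i + 1
  | .zero => 0
  | .one => 0
  | .add t u => max t.bound u.bound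
  | .mul t u => max t.bound u.bound

/-- A strict upper bound of the free number variables of a formula. -/
def Fml.bound : Fml → ℕ
  | .eq t u => max t.bound u.bound
  | .lt t u => max t.bound u.bound
  | .mem t _ => t.bound
  | .not φ => φ.bound
  | .and φ ψ => max φ.bound ψ.bound
  | .or φ ψ => max φ.bound ψ.bound
  | .imp φ ψ => max φ.bound ψ.bound
  | .all _ φ => φ.bound
  | .ex _ φ => φ.bound
  | .ball _ t φ => max t.bound φ.bound
  | .bex _ t φ => max t.bound φ.bound
  | .sall _ φ => φ.bound
  | .sex _ φ => φ.bound

/-- Capture-avoiding substitution of the terms `f i` for the number variables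
of a formula; bound variables are replaced by the variables from `N` on, which
must not occur in the terms `f i`. -/
def Fml.subst : Fml → ℕ → (ℕ → Term) → Fml
  | .eq t u, _, f => .eq (t.subst f) (u.subst f)
  | .lt t u, _, f => .lt (t.subst f) (u.subst f)
  | .mem t i, _, f => .mem (t.subst f) i
  | .not φ, N, f => .not (φ.subst N f)
  | .and φ ψ, N, f => .and (φ.subst N f) (ψ.subst N f)
  | .or φ ψ, N, f => .or (φ.subst N f) (ψ.subst N f)
  | .imp φ ψ, N, f => .imp (φ.subst N f) (ψ.subst N f)
  | .all x φ, N, f => .all N (φ.subst (N + 1) (Function.update f x (.var N)))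
  | .ex x φ, N, f => .ex N (φ.subst (N + 1) (Function.update f x (.var N)))
  | .ball x t φ, N, f =>
      .ball N (t.subst f) (φ.subst (N + 1) (Function.update f x (.var N)))
  | .bex x t φ, N, f =>
      .bex N (t.subst f) (φ.subst (N + 1) (Function.update f x (.var N)))
  | .sall i φ, N, f => .sall i (φ.subst N f)
  | .sex i φ, N, f => .sex i (φ.subst N f)

theorem tval_subst (S : Str) (v : ℕ → S.M) (f : ℕ → Term) (t : Term) :
    tval S v (t.subst f) = tval S (fun i => tval S v (f i)) t := by
  induction t <;> simp_all [Term.subst, tval]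

theorem tval_congr (S : Str) {v v' : ℕ → S.M} {t : Term}
    (h : ∀ i < t.bound, v i = v' i) : tval S v t = tval S v' t := by
  induction t <;> simp_all [Term.bound, tval]

theorem upd_congr {α : Type} {v v' : ℕ → α} {K : ℕ} (h : ∀ i < K, v i = v' i) (x : ℕ) (m : α) :
    ∀ i < K, upd v x m i = upd v' x m i := by
  intro i hi
  unfold upd
  rw [h i hi]

theorem sat_congr (S : Str) (X : Set (Set S.M)) (φ : Fml) :
    ∀ {v v' : ℕ → S.M} {w : ℕ → Set S.M}, (∀ i < φ.bound, v i = v' i) →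
      (Sat S X v w φ ↔ Sat S X v' w φ) := by
  induction φ with
  | eq t u =>
    intro v v' w h
    simp only [Fml.bound, lt_max_iff] at h
    simp only [Sat]
    rw [tval_congr S fun i hi => h i (.inl hi), tval_congr S fun i hi => h i (.inr hi)]
  | lt t u =>
    intro v v' w h
    simp only [Fml.bound, lt_max_iff] at h
    simp only [Sat]
    rw [tval_congr S fun i hi => h i (.inl hi), tval_congr S fun i hi => h i (.inr hi)]
  | mem t i =>
    intro v v' w h
    simp only [Sat]
    rw [tval_congr S h]
  | not φ ih => intro v v' w h; exact not_congr (ih h)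
  | and φ ψ ih ih' =>
    intro v v' w h
    simp only [Fml.bound, lt_max_iff] at h
    exact and_congr (ih fun i hi => h i (.inl hi)) (ih' fun i hi => h i (.inr hi))
  | or φ ψ ih ih' =>
    intro v v' w h
    simp only [Fml.bound, lt_max_iff] at h
    exact or_congr (ih fun i hi => h i (.inl hi)) (ih' fun i hi => h i (.inr hi))
  | imp φ ψ ih ih' =>
    intro v v' w h
    simp only [Fml.bound, lt_max_iff] at h
    exact imp_congr (ih fun i hi => h i (.inl hi)) (ih' fun i hi => h i (.inr hi))
  | all x φ ih => intro v v' w h; exact forall_congr' fun m => ih (upd_congr h x m)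
  | ex x φ ih => intro v v' w h; exact exists_congr fun m => ih (upd_congr h x m)
  | ball x t φ ih =>
    intro v v' w h
    simp only [Fml.bound, lt_max_iff] at h
    simp only [Sat]
    rw [tval_congr S fun i hi => h i (.inl hi)]
    exact forall_congr' fun m => imp_congr_right fun _ =>
      ih (upd_congr (fun i hi => h i (.inr hi)) x m)
  | bex x t φ ih =>
    intro v v' w h
    simp only [Fml.bound, lt_max_iff] at h
    simp only [Sat]
    rw [tval_congr S fun i hi => h i (.inl hi)]
    exact exists_congr fun m => and_congr_right fun _ =>
      ih (upd_congr (fun i hi => h i (.inr hi)) x m)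
  | sall i φ ih => intro v v' w h; exact forall_congr' fun A => imp_congr_right fun _ => ih h
  | sex i φ ih => intro v v' w h; exact exists_congr fun A => and_congr_right fun _ => ih h

theorem bound_update_le {f : ℕ → Term} {N : ℕ} (hf : ∀ i, (f i).bound ≤ N) (x i : ℕ) :
    (Function.update f x (.var N) i).bound ≤ N + 1 := by
  by_cases h : i = x
  · subst h; simp [Term.bound]
  · simpa [h] using (hf i).trans (Nat.le_succ N)

theorem tval_upd_update (S : Str) (v : ℕ → S.M) {f : ℕ → Term} {N : ℕ}
    (hf : ∀ i, (f i).bound ≤ N) (x : ℕ) (m : S.M) :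
    (fun i => tval S (upd v N m) (Function.update f x (.var N) i)) =
      upd (fun i => tval S v (f i)) x m := by
  funext i
  by_cases h : i = x
  · subst h; simp [tval, upd]
  · rw [Function.update_of_ne h, upd, if_neg h]
    refine tval_congr S fun j hj => ?_
    exact if_neg (hj.trans_le (hf i)).ne

theorem sat_subst (S : Str) (X : Set (Set S.M)) (φ : Fml) :
    ∀ (v : ℕ → S.M) (w : ℕ → Set S.M) (N : ℕ) (f : ℕ → Term), (∀ i, (f i).bound ≤ N) →
      (Sat S X v w (φ.subst N f) ↔ Sat S X (fun i => tval S v (f i)) w φ) := by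
  induction φ with
  | eq t u => intro v w N f _; simp [Fml.subst, Sat, tval_subst]
  | lt t u => intro v w N f _; simp [Fml.subst, Sat, tval_subst]
  | mem t i => intro v w N f _; simp [Fml.subst, Sat, tval_subst]
  | not φ ih => intro v w N f hf; exact not_congr (ih v w N f hf)
  | and φ ψ ih ih' => intro v w N f hf; exact and_congr (ih v w N f hf) (ih' v w N f hf)
  | or φ ψ ih ih' => intro v w N f hf; exact or_congr (ih v w N f hf) (ih' v w N f hf)
  | imp φ ψ ih ih' => intro v w N f hf; exact imp_congr (ih v w N f hf) (ih' v w N f hf)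
  | all x φ ih =>
    intro v w N f hf
    refine forall_congr' fun m => ?_
    rw [ih _ w _ _ (bound_update_le hf x), tval_upd_update S v hf]
  | ex x φ ih =>
    intro v w N f hf
    refine exists_congr fun m => ?_
    rw [ih _ w _ _ (bound_update_le hf x), tval_upd_update S v hf]
  | ball x t φ ih =>
    intro v w N f hf
    simp only [Fml.subst, Sat, tval_subst]
    refine forall_congr' fun m => imp_congr_right fun _ => ?_
    rw [ih _ w _ _ (bound_update_le hf x), tval_upd_update S v hf]
  | bex x t φ ih =>
    intro v w N f hf
    simp only [Fml.subst, Sat, tval_subst]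
    refine exists_congr fun m => and_congr_right fun _ => ?_
    rw [ih _ w _ _ (bound_update_le hf x), tval_upd_update S v hf]
  | sall i φ ih =>
    intro v w N f hf
    exact forall_congr' fun A => imp_congr_right fun _ => ih v _ N f hf
  | sex i φ ih =>
    intro v w N f hf
    exact exists_congr fun A => and_congr_right fun _ => ih v _ N f hf

/-- A class of formulas is closed under substitution. -/
def SubstClosed (Γ : Fml → Prop) : Prop :=
  ∀ φ, Γ φ → ∀ N f, Γ (φ.subst N f)

theorem substClosed_delta0 : SubstClosed Delta0 := by
  intro φ h
  induction h with
  | eq => exact fun _ _ => .eq _ _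
  | lt => exact fun _ _ => .lt _ _
  | not _ ih => exact fun N f => .not (ih N f)
  | and _ _ ih ih' => exact fun N f => .and (ih N f) (ih' N f)
  | or _ _ ih ih' => exact fun N f => .or (ih N f) (ih' N f)
  | imp _ _ ih ih' => exact fun N f => .imp (ih N f) (ih' N f)
  | ball x t _ ih => exact fun N f => .ball _ _ (ih _ _)
  | bex x t _ ih => exact fun N f => .bex _ _ (ih _ _)

mutual
theorem IsSigma.subst {n : ℕ} {φ : Fml} (h : IsSigma n φ) (N : ℕ) (f : ℕ → Term) :
    IsSigma n (φ.subst N f) := by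
  cases h with
  | delta0 h => exact .delta0 (substClosed_delta0 _ h N f)
  | ofPi h => exact .ofPi (h.subst N f)
  | ex x h => exact .ex _ (h.subst _ _)

theorem IsPi.subst {n : ℕ} {φ : Fml} (h : IsPi n φ) (N : ℕ) (f : ℕ → Term) :
    IsPi n (φ.subst N f) := by
  cases h with
  | delta0 h => exact .delta0 (substClosed_delta0 _ h N f)
  | ofSigma h => exact .ofSigma (h.subst N f)
  | all x h => exact .all _ (h.subst _ _)
end

theorem substClosed_isSigma (n : ℕ) : SubstClosed (IsSigma n) := fun _ h => h.subst

theorem substClosed_isPi (n : ℕ) : SubstClosed (IsPi n) := fun _ h => h.subst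

/-! ### Predicates definable with parameters -/

/-- Prepend a value to a valuation. -/
def vcons {α : Type} (m : α) (v : ℕ → α) : ℕ → α
  | 0 => m
  | i + 1 => v i

/-- The valuation taking the values of `v` at the left variables and those of
the parameter sequence `p` at the right ones, under `ℕ ⊕ ℕ ≃ ℕ`. -/
def withParams {α : Type} (v p : ℕ → α) (i : ℕ) : α :=
  Sum.elim v p (Equiv.natSumNatEquivNat.symm i)

/-- The variable that `withParams` assigns to the argument `i`. -/
def argVar (i : ℕ) : ℕ := Equiv.natSumNatEquivNat (Sum.inl i)

/-- The variable that `withParams` assigns to the parameter `i`. -/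
def parVar (i : ℕ) : ℕ := Equiv.natSumNatEquivNat (Sum.inr i)

theorem withParams_argVar {α : Type} (v p : ℕ → α) (i : ℕ) :
    withParams v p (argVar i) = v i := by
  rw [withParams, argVar, Equiv.symm_apply_apply]; rfl

theorem withParams_parVar {α : Type} (v p : ℕ → α) (i : ℕ) :
    withParams v p (parVar i) = p i := by
  rw [withParams, parVar, Equiv.symm_apply_apply]; rfl

theorem argVar_or_parVar (i : ℕ) : (∃ k, i = argVar k) ∨ ∃ k, i = parVar k := by
  obtain ⟨k | k, rfl⟩ := Equiv.natSumNatEquivNat.surjective i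
  exacts [.inl ⟨k, rfl⟩, .inr ⟨k, rfl⟩]

theorem argVar_injective : Function.Injective argVar := fun _ _ h =>
  Sum.inl_injective (Equiv.natSumNatEquivNat.injective h)

theorem parVar_ne_argVar (i j : ℕ) : parVar i ≠ argVar j := fun h =>
  Sum.inr_ne_inl (Equiv.natSumNatEquivNat.injective h)

theorem upd_withParams {α : Type} (v p : ℕ → α) (i : ℕ) (m : α) :
    upd (withParams v p) (argVar i) m = withParams (upd v i m) p := by
  funext j
  obtain ⟨k, rfl⟩ | ⟨k, rfl⟩ := argVar_or_parVar j
  · simp [withParams_argVar, upd, argVar_injective.eq_iff]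
  · simp [withParams_parVar, upd, parVar_ne_argVar]

theorem upd_vcons {α : Type} (a m : α) (v : ℕ → α) : upd (vcons a v) 0 m = vcons m v := by
  funext i
  cases i <;> simp [upd, vcons]

section Definability

variable {S : Str}

/-- Polynomial functions of a valuation, with parameters. -/
inductive IsPoly (S : Str) : ((ℕ → S.M) → S.M) → Prop
  | var (i : ℕ) : IsPoly S fun v => v i
  | const (a : S.M) : IsPoly S fun _ => a
  | add {f g} : IsPoly S f → IsPoly S g → IsPoly S fun v => S.add (f v) (g v)
  | mul {f g} : IsPoly S f → IsPoly S g → IsPoly S fun v => S.mul (f v) (g v)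

/-- Maps between valuations with polynomial components. -/
def IsPolyMap (S : Str) (g : (ℕ → S.M) → ℕ → S.M) : Prop := ∀ i, IsPoly S fun v => g v i

theorem IsPoly.comp {f : (ℕ → S.M) → S.M} (hf : IsPoly S f) {g : (ℕ → S.M) → ℕ → S.M}
    (hg : IsPolyMap S g) : IsPoly S fun v => f (g v) := by
  induction hf with
  | var i => exact hg i
  | const a => exact .const a
  | add _ _ ih ih' => exact .add ih ih'
  | mul _ _ ih ih' => exact .mul ih ih'

theorem IsPolyMap.id : IsPolyMap S fun v => v := IsPoly.var

theorem IsPolyMap.vcons {f : (ℕ → S.M) → S.M} (hf : IsPoly S f) {g : (ℕ → S.M) → ℕ → S.M}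
    (hg : IsPolyMap S g) : IsPolyMap S fun v => vcons (f v) (g v) := by
  rintro (_ | i)
  exacts [hf, hg i]

theorem IsPolyMap.const (w : ℕ → S.M) : IsPolyMap S fun _ => w := fun i => .const (w i)

theorem IsPolyMap.upd {f : (ℕ → S.M) → S.M} (hf : IsPoly S f) {g : (ℕ → S.M) → ℕ → S.M}
    (hg : IsPolyMap S g) (x : ℕ) : IsPolyMap S fun v => upd (g v) x (f v) := by
  intro i
  by_cases h : i = x
  · simpa [PaperArith.upd, h] using hf
  · simpa [PaperArith.upd, h] using hg i

theorem IsPolyMap.drop (k : ℕ) : IsPolyMap S fun v i => v (i + k) := fun _ => .var _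

theorem IsPolyMap.comp {f g : (ℕ → S.M) → ℕ → S.M} (hf : IsPolyMap S f) (hg : IsPolyMap S g) :
    IsPolyMap S fun v => f (g v) := fun i => (hf i).comp hg

theorem IsPolyMap.withParams {g h : (ℕ → S.M) → ℕ → S.M} (hg : IsPolyMap S g)
    (hh : IsPolyMap S h) : IsPolyMap S fun v => withParams (g v) (h v) := by
  intro i
  obtain ⟨k, rfl⟩ | ⟨k, rfl⟩ := argVar_or_parVar i
  · simpa only [withParams_argVar] using hg k
  · simpa only [withParams_parVar] using hh k

theorem tval_subst_withParams (v p q : ℕ → S.M) (j : ℕ → ℕ) (h : ∀ k, p k = q (j k)) (t : Term) :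
    tval S (withParams v p) t = tval S (withParams v q)
      (t.subst (withParams (fun i => .var (argVar i)) fun i => .var (parVar (j i)))) := by
  rw [tval_subst]
  congr 1
  funext i
  obtain ⟨k, rfl⟩ | ⟨k, rfl⟩ := argVar_or_parVar i <;>
    simp [tval, withParams_argVar, withParams_parVar, h]

theorem IsPoly.exists_term {f : (ℕ → S.M) → S.M} (hf : IsPoly S f) :
    ∃ (t : Term) (p : ℕ → S.M), ∀ v, f v = tval S (withParams v p) t := by
  have key : ∀ (f g : (ℕ → S.M) → S.M),
      (∃ (t : Term) (p : ℕ → S.M), ∀ v, f v = tval S (withParams v p) t) →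
      (∃ (t : Term) (p : ℕ → S.M), ∀ v, g v = tval S (withParams v p) t) →
      ∃ (t u : Term) (p : ℕ → S.M), (∀ v, f v = tval S (withParams v p) t) ∧
        ∀ v, g v = tval S (withParams v p) u := by
    rintro f g ⟨t, p, ht⟩ ⟨u, q, hu⟩
    exact ⟨_, _, withParams p q,
      fun v => (ht v).trans (tval_subst_withParams v p _ argVar
        (fun k => (withParams_argVar p q k).symm) t),
      fun v => (hu v).trans (tval_subst_withParams v q _ parVar
        (fun k => (withParams_parVar p q k).symm) u)⟩
  induction hf with
  | var i => exact ⟨.var (argVar i), fun _ => S.zero, fun v => by simp [tval, withParams_argVar]⟩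
  | const a => exact ⟨.var (parVar 0), fun _ => a, fun v => by simp [tval, withParams_parVar]⟩
  | add _ _ ih ih' =>
    obtain ⟨t, u, p, ht, hu⟩ := key _ _ ih ih'
    exact ⟨.add t u, p, fun v => by simp [tval, ht, hu]⟩
  | mul _ _ ih ih' =>
    obtain ⟨t, u, p, ht, hu⟩ := key _ _ ih ih'
    exact ⟨.mul t u, p, fun v => by simp [tval, ht, hu]⟩

theorem IsPolyMap.exists_terms {g : (ℕ → S.M) → ℕ → S.M} (hg : IsPolyMap S g) :
    ∃ (T : ℕ → Term) (p : ℕ → S.M), ∀ v i, g v i = tval S (PaperArith.withParams v p) (T i) := by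
  choose t p h using fun i => (hg i).exists_term
  exact ⟨_, fun j => p j.unpair.1 j.unpair.2, fun v i => (h i v).trans
    (tval_subst_withParams v (p i) _ (Nat.pair i) (fun k => by simp) (t i))⟩

theorem SubstClosed.exists_subst {Γ : Fml → Prop} (hΓ : SubstClosed Γ) {φ : Fml} (hφ : Γ φ)
    {g e : (ℕ → S.M) → ℕ → S.M} {T : ℕ → Term} (hT : ∀ v i, g v i = tval S (e v) (T i)) :
    ∃ ψ, Γ ψ ∧ ∀ v, Sat0 S (g v) φ ↔ Sat0 S (e v) ψ := by
  let f : ℕ → Term := fun i => if i < φ.bound then T i else .zero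
  let N := (Finset.range φ.bound).sup fun i => (T i).bound
  refine ⟨φ.subst N f, hΓ φ hφ N f, fun v => ?_⟩
  unfold Sat0
  rw [sat_subst]
  · refine sat_congr S _ φ fun i hi => ?_
    simp [f, hi, hT]
  · intro i
    by_cases hi : i < φ.bound
    · simpa [f, hi] using
        Finset.le_sup (f := fun i => (T i).bound) (Finset.mem_range.mpr hi)
    · simp [f, hi, Term.bound]

/-- `P` is definable, with parameters, by a formula in `Γ`. -/
def DefBy (S : Str) (Γ : Fml → Prop) (P : (ℕ → S.M) → Prop) : Prop :=
  ∃ φ, Γ φ ∧ ∃ g, IsPolyMap S g ∧ ∀ v, P v ↔ Sat0 S (g v) φ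

variable {Γ Γ' : Fml → Prop} {P Q : (ℕ → S.M) → Prop}

theorem DefBy.comp (hP : DefBy S Γ P) {g : (ℕ → S.M) → ℕ → S.M} (hg : IsPolyMap S g) :
    DefBy S Γ fun v => P (g v) := by
  obtain ⟨φ, hφ, e, he, h⟩ := hP
  exact ⟨φ, hφ, _, he.comp hg, fun v => h _⟩

theorem DefBy.congr (hP : DefBy S Γ P) (h : ∀ v, P v ↔ Q v) : DefBy S Γ Q := by
  obtain ⟨φ, hφ, e, he, h'⟩ := hP
  exact ⟨φ, hφ, e, he, fun v => (h v).symm.trans (h' v)⟩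

theorem DefBy.mono (hP : DefBy S Γ P) (h : ∀ φ, Γ φ → Γ' φ) : DefBy S Γ' P := by
  obtain ⟨φ, hφ, e, he, h'⟩ := hP
  exact ⟨φ, h φ hφ, e, he, h'⟩

theorem DefBy.normal_form_with (hΓ : SubstClosed Γ) (hP : DefBy S Γ P)
    {g : (ℕ → S.M) → ℕ → S.M} (hg : IsPolyMap S g) :
    ∃ (φ : Fml) (p : ℕ → S.M) (T : ℕ → Term), Γ φ ∧ (∀ v, P v ↔ Sat0 S (withParams v p) φ) ∧
      ∀ v i, g v i = tval S (withParams v p) (T i) := by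
  obtain ⟨φ, hφ, e, he, h⟩ := hP
  obtain ⟨T, p, hT⟩ := (he.withParams hg).exists_terms
  obtain ⟨ψ, hψ, h'⟩ := hΓ.exists_subst hφ (g := e) (e := fun v => withParams v p)
    (T := fun i => T (argVar i)) fun v i => by rw [← hT, withParams_argVar]
  exact ⟨ψ, p, fun i => T (parVar i), hψ, fun v => (h v).trans (h' v),
    fun v i => by rw [← hT, withParams_parVar]⟩

theorem DefBy.normal_form (hΓ : SubstClosed Γ) (hP : DefBy S Γ P) :
    ∃ φ p, Γ φ ∧ ∀ v, P v ↔ Sat0 S (withParams v p) φ := by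
  obtain ⟨φ, p, _, hφ, h, _⟩ := hP.normal_form_with hΓ IsPolyMap.id
  exact ⟨φ, p, hφ, h⟩

theorem DefBy.normal_form₂ (hΓ : SubstClosed Γ) (hΓ' : SubstClosed Γ') (hP : DefBy S Γ P)
    (hQ : DefBy S Γ' Q) :
    ∃ φ ψ p, Γ φ ∧ Γ' ψ ∧ (∀ v, P v ↔ Sat0 S (withParams v p) φ) ∧
      ∀ v, Q v ↔ Sat0 S (withParams v p) ψ := by
  obtain ⟨ψ, hψ, g, hg, hQ⟩ := hQ
  obtain ⟨φ, p, T, hφ, h, hT⟩ := hP.normal_form_with hΓ hg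
  obtain ⟨χ, hχ, h'⟩ := hΓ'.exists_subst hψ hT
  exact ⟨φ, χ, p, hφ, hχ, h, fun v => (hQ v).trans (h' v)⟩

theorem withParams_vcons (v p : ℕ → S.M) (a m : S.M) :
    upd (withParams (vcons a v) p) (argVar 0) m = withParams (vcons m v) p := by
  rw [upd_withParams, upd_vcons]

theorem IsPolyMap.withParams_vcons (p : ℕ → S.M) (a : S.M) :
    IsPolyMap S fun v => PaperArith.withParams (PaperArith.vcons a v) p :=
  (IsPolyMap.vcons (.const a) .id).withParams (.const p)

theorem DefBy.ex {k : ℕ} (hP : DefBy S (IsPi k) P) :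
    DefBy S (IsSigma (k + 1)) fun v => ∃ m, P (vcons m v) := by
  obtain ⟨φ, p, hφ, h⟩ := hP.normal_form (substClosed_isPi k)
  refine ⟨.ex (argVar 0) φ, .ex _ (.ofPi hφ), _, .withParams_vcons p S.zero, fun v => ?_⟩
  refine exists_congr fun m => ?_
  rw [PaperArith.withParams_vcons, h]; rfl

theorem DefBy.all {k : ℕ} (hP : DefBy S (IsSigma k) P) :
    DefBy S (IsPi (k + 1)) fun v => ∀ m, P (vcons m v) := by
  obtain ⟨φ, p, hφ, h⟩ := hP.normal_form (substClosed_isSigma k)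
  refine ⟨.all (argVar 0) φ, .all _ (.ofSigma hφ), _, .withParams_vcons p S.zero, fun v => ?_⟩
  refine forall_congr' fun m => ?_
  rw [PaperArith.withParams_vcons, h]; rfl

theorem DefBy.eq {s t : (ℕ → S.M) → S.M} (hs : IsPoly S s) (ht : IsPoly S t) :
    DefBy S Delta0 fun v => s v = t v :=
  ⟨.eq (.var 0) (.var 1), .eq _ _, _, .vcons hs (.vcons ht .id), fun _ => Iff.rfl⟩

theorem DefBy.lt {s t : (ℕ → S.M) → S.M} (hs : IsPoly S s) (ht : IsPoly S t) :
    DefBy S Delta0 fun v => S.lt (s v) (t v) :=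
  ⟨.lt (.var 0) (.var 1), .lt _ _, _, .vcons hs (.vcons ht .id), fun _ => Iff.rfl⟩

theorem DefBy.not (hP : DefBy S Delta0 P) : DefBy S Delta0 fun v => ¬ P v := by
  obtain ⟨φ, hφ, g, hg, h⟩ := hP
  exact ⟨.not φ, .not hφ, g, hg, fun v => not_congr (h v)⟩

theorem DefBy.and (hP : DefBy S Delta0 P) (hQ : DefBy S Delta0 Q) :
    DefBy S Delta0 fun v => P v ∧ Q v := by
  obtain ⟨φ, ψ, p, hφ, hψ, h, h'⟩ := hP.normal_form₂ substClosed_delta0 substClosed_delta0 hQ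
  exact ⟨.and φ ψ, .and hφ hψ, _, IsPolyMap.id.withParams (.const p), fun v => and_congr (h v) (h' v)⟩

theorem DefBy.ball (hP : DefBy S Delta0 P) {t : (ℕ → S.M) → S.M} (ht : IsPoly S t) :
    DefBy S Delta0 fun v => ∀ m, S.lt m (t v) → P (vcons m v) := by
  obtain ⟨φ, p, T, hφ, h, hT⟩ := hP.normal_form_with substClosed_delta0
    (g := fun v _ => t fun i => v (i + 1)) fun _ => ht.comp (.drop 1)
  refine ⟨.ball (argVar 0) (T 0) φ, .ball _ _ hφ, _, .withParams_vcons p S.zero, fun v => ?_⟩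
  refine forall_congr' fun m => imp_congr ?_ ?_
  · rw [← hT]; rfl
  · rw [PaperArith.withParams_vcons, h]; rfl

end Definability

/-! ### The semantic arithmetic hierarchy -/

section Hierarchy

variable {S : Str} {k : ℕ} {P Q : (ℕ → S.M) → Prop}

/-- Predicates obtained from `Δ₀` ones by `k` alternating unbounded
quantifiers, the outermost being existential; `P` is a `Πₖ` predicate when
`SigmaRel S k fun v => ¬ P v`. -/
def SigmaRel (S : Str) : ℕ → ((ℕ → S.M) → Prop) → Prop
  | 0, P => DefBy S Delta0 P
  | k + 1, P => ∃ Q : (ℕ → S.M) → Prop, SigmaRel S k (fun v => ¬ Q v) ∧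
      ∀ v, P v ↔ ∃ m, Q (vcons m v)

theorem SigmaRel.congr (hP : SigmaRel S k P) (h : ∀ v, P v ↔ Q v) : SigmaRel S k Q := by
  cases k with
  | zero => exact DefBy.congr hP h
  | succ k =>
    obtain ⟨R, hR, h'⟩ := hP
    exact ⟨R, hR, fun v => (h v).symm.trans (h' v)⟩

theorem SigmaRel.comp (hP : SigmaRel S k P) {g : (ℕ → S.M) → ℕ → S.M} (hg : IsPolyMap S g) :
    SigmaRel S k fun v => P (g v) := by
  induction k generalizing P g with
  | zero => exact DefBy.comp hP hg
  | succ k ih =>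
    obtain ⟨R, hR, h⟩ := hP
    refine ⟨fun v => R (vcons (v 0) (g fun i => v (i + 1))),
      ih hR (.vcons (.var 0) (hg.comp (.drop 1))), fun v => ?_⟩
    exact h _

theorem SigmaRel.compl_compl (hP : SigmaRel S k P) : SigmaRel S k fun v => ¬ ¬ P v :=
  hP.congr fun _ => not_not.symm

theorem SigmaRel.compl_succ (hP : SigmaRel S k P) : SigmaRel S (k + 1) fun v => ¬ P v :=
  ⟨fun v => ¬ P fun i => v (i + 1), (hP.comp (.drop 1)).compl_compl,
    fun _ => ⟨fun h => ⟨S.zero, h⟩, fun ⟨_, h⟩ => h⟩⟩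

theorem SigmaRel.succ (hP : SigmaRel S k P) : SigmaRel S (k + 1) P := by
  induction k generalizing P with
  | zero => exact (SigmaRel.compl_succ (k := 0) (DefBy.not hP)).congr fun _ => not_not
  | succ k ih =>
    obtain ⟨R, hR, h⟩ := hP
    exact ⟨R, ih hR, h⟩

theorem SigmaRel.mono {j : ℕ} (hjk : j ≤ k) (hP : SigmaRel S j P) : SigmaRel S k P := by
  induction hjk with
  | refl => exact hP
  | step _ ih => exact ih.succ

theorem DefBy.sigmaRel (hP : DefBy S Delta0 P) : SigmaRel S k P :=
  SigmaRel.mono (j := 0) (Nat.zero_le k) hP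

theorem SigmaRel.defBy (hP : SigmaRel S k P) :
    DefBy S (IsSigma k) P ∧ DefBy S (IsPi k) fun v => ¬ P v := by
  induction k generalizing P with
  | zero => exact ⟨DefBy.mono hP fun _ => .delta0, DefBy.mono (DefBy.not hP) fun _ => .delta0⟩
  | succ k ih =>
    obtain ⟨R, hR, h⟩ := hP
    obtain ⟨h₁, h₂⟩ := ih hR
    refine ⟨((h₂.congr fun _ => not_not).ex).congr fun v => (h v).symm,
      h₁.all.congr fun v => ?_⟩
    rw [h, not_exists]

/-- `Σₖ` predicates (hence, dually, `Πₖ` predicates) are closed under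
conjunction, disjunction and bounded quantification. -/
structure BddClosed (S : Str) (k : ℕ) : Prop where
  and : ∀ {P Q : (ℕ → S.M) → Prop}, SigmaRel S k P → SigmaRel S k Q →
    SigmaRel S k fun v => P v ∧ Q v
  or : ∀ {P Q : (ℕ → S.M) → Prop}, SigmaRel S k P → SigmaRel S k Q →
    SigmaRel S k fun v => P v ∨ Q v
  ball : ∀ {P : (ℕ → S.M) → Prop} {t : (ℕ → S.M) → S.M}, SigmaRel S k P → IsPoly S t →
    SigmaRel S k fun v => ∀ m, S.lt m (t v) → P (vcons m v)
  bex : ∀ {P : (ℕ → S.M) → Prop} {t : (ℕ → S.M) → S.M}, SigmaRel S k P → IsPoly S t →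
    SigmaRel S k fun v => ∃ m, S.lt m (t v) ∧ P (vcons m v)

theorem bddClosed_zero : BddClosed S 0 where
  and h h' := DefBy.and h h'
  or h h' := (DefBy.not (DefBy.and (DefBy.not h) (DefBy.not h'))).congr fun v => by tauto
  ball h ht := DefBy.ball h ht
  bex h ht := (DefBy.not (DefBy.ball (DefBy.not h) ht)).congr fun v => by push Not; rfl

theorem BddClosed.ball_curried (C : BddClosed S k) {P : S.M → (ℕ → S.M) → Prop}
    {t : (ℕ → S.M) → S.M} (hP : SigmaRel S k fun v => P (v 0) fun i => v (i + 1))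
    (ht : IsPoly S t) : SigmaRel S k fun v => ∀ m, S.lt m (t v) → P m v :=
  C.ball hP ht

theorem BddClosed.bex_curried (C : BddClosed S k) {P : S.M → (ℕ → S.M) → Prop}
    {t : (ℕ → S.M) → S.M} (hP : SigmaRel S k fun v => P (v 0) fun i => v (i + 1))
    (ht : IsPoly S t) : SigmaRel S k fun v => ∃ m, S.lt m (t v) ∧ P m v :=
  C.bex hP ht

theorem BddClosed.compl_bex (C : BddClosed S k) {P : S.M → (ℕ → S.M) → Prop}
    {t : (ℕ → S.M) → S.M} (hP : SigmaRel S k fun v => ¬ P (v 0) fun i => v (i + 1))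
    (ht : IsPoly S t) : SigmaRel S k fun v => ¬ ∃ m, S.lt m (t v) ∧ P m v :=
  (C.ball hP ht).congr fun v => by push Not; rfl

theorem BddClosed.compl_ball (C : BddClosed S k) {P : S.M → (ℕ → S.M) → Prop}
    {t : (ℕ → S.M) → S.M} (hP : SigmaRel S k fun v => ¬ P (v 0) fun i => v (i + 1))
    (ht : IsPoly S t) : SigmaRel S k fun v => ¬ ∀ m, S.lt m (t v) → P m v :=
  (C.bex hP ht).congr fun v => by push Not; rfl

theorem BddClosed.compl_and (C : BddClosed S k) (hP : SigmaRel S k fun v => ¬ P v)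
    (hQ : SigmaRel S k fun v => ¬ Q v) : SigmaRel S k fun v => ¬ (P v ∧ Q v) :=
  (C.or hP hQ).congr fun _ => not_and_or.symm

theorem BddClosed.compl_or (C : BddClosed S k) (hP : SigmaRel S k fun v => ¬ P v)
    (hQ : SigmaRel S k fun v => ¬ Q v) : SigmaRel S k fun v => ¬ (P v ∨ Q v) :=
  (C.and hP hQ).congr fun _ => not_or.symm

theorem SigmaRel.comp₁ {P : S.M → Prop} (hP : SigmaRel S k fun v => P (v 0))
    {s : (ℕ → S.M) → S.M} (hs : IsPoly S s) : SigmaRel S k fun v => P (s v) :=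
  hP.comp (.vcons hs .id)

theorem SigmaRel.comp₂ {R : S.M → S.M → Prop} (hR : SigmaRel S k fun v => R (v 0) (v 1))
    {s t : (ℕ → S.M) → S.M} (hs : IsPoly S s) (ht : IsPoly S t) :
    SigmaRel S k fun v => R (s v) (t v) :=
  hR.comp (.vcons hs (.vcons ht .id))

theorem SigmaRel.exists_compl {P : S.M → (ℕ → S.M) → Prop}
    (hP : SigmaRel S k fun v => ¬ P (v 0) fun i => v (i + 1)) :
    SigmaRel S (k + 1) fun v => ∃ m, P m v :=
  ⟨_, hP, fun _ => Iff.rfl⟩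

theorem SigmaRel.exists_of_bddClosed (C : BddClosed S k) {P : S.M → (ℕ → S.M) → Prop}
    {u : S.M → S.M → S.M} (hu : ∀ a b, S.lt a (u a b) ∧ S.lt b (u a b))
    (hP : SigmaRel S (k + 1) fun v => P (v 0) fun i => v (i + 1)) :
    SigmaRel S (k + 1) fun v => ∃ m, P m v := by
  obtain ⟨R, hR, h⟩ := hP
  refine SigmaRel.congr (.exists_compl (k := k)
    (P := fun b v => ∃ m, S.lt m b ∧ ∃ i, S.lt i b ∧ R (vcons i (vcons m v)))
    (C.compl_bex (C.compl_bex (hR.comp ?_) (.var 1)) (.var 0))) fun v => ?_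
  · exact .vcons (.var 0) (.vcons (.var 1) (.drop 3))
  · constructor
    · rintro ⟨b, m, -, i, -, hi⟩
      exact ⟨m, (h (vcons m v)).2 ⟨i, hi⟩⟩
    · rintro ⟨m, hm⟩
      obtain ⟨i, hi⟩ := (h (vcons m v)).1 hm
      exact ⟨u m i, m, (hu m i).1, i, (hu m i).2, hi⟩

end Hierarchy

/-! ### Arithmetic in models of `PA⁻` -/

section Arithmetic

variable {S : Str} [hPA : Fact (PAminus S)]

instance : CommSemiring S.M where
  add := S.add
  zero := S.zero
  mul := S.mul
  one := S.one
  add_assoc := hPA.out.add_assoc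
  add_comm := hPA.out.add_comm
  zero_add a := (hPA.out.add_comm _ _).trans (hPA.out.add_zero a)
  add_zero := hPA.out.add_zero
  mul_assoc := hPA.out.mul_assoc
  mul_comm := hPA.out.mul_comm
  mul_one := hPA.out.mul_one
  one_mul a := (hPA.out.mul_comm _ _).trans (hPA.out.mul_one a)
  mul_zero := hPA.out.mul_zero
  zero_mul a := (hPA.out.mul_comm _ _).trans (hPA.out.mul_zero a)
  left_distrib := hPA.out.distrib
  right_distrib a b c := by
    refine (hPA.out.mul_comm _ _).trans ((hPA.out.distrib c a b).trans ?_)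
    exact congrArg₂ S.add (hPA.out.mul_comm _ _) (hPA.out.mul_comm _ _)
  nsmul := @nsmulRec S.M ⟨S.zero⟩ ⟨S.add⟩

noncomputable instance : LinearOrder S.M where
  le a b := a = b ∨ S.lt a b
  lt := S.lt
  le_refl _ := .inl rfl
  le_trans a b c := by
    rintro (rfl | h) (rfl | h')
    exacts [.inl rfl, .inr h', .inr h, .inr (hPA.out.lt_trans _ _ _ h h')]
  lt_iff_le_not_ge a b := by
    refine ⟨fun h => ⟨.inr h, ?_⟩, ?_⟩
    · rintro (rfl | h')
      exacts [hPA.out.lt_irrefl _ h, hPA.out.lt_irrefl _ (hPA.out.lt_trans _ _ _ h h')]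
    · rintro ⟨rfl | h, h'⟩
      exacts [(h' (.inl rfl)).elim, h]
  le_antisymm a b := by
    rintro (rfl | h) (h' | h')
    exacts [rfl, rfl, h'.symm, (hPA.out.lt_irrefl _ (hPA.out.lt_trans _ _ _ h h')).elim]
  le_total a b := by
    rcases hPA.out.lt_total a b with h | h | h
    exacts [.inl (.inr h), .inl (.inl h), .inr (.inr h)]
  toDecidableLE := Classical.decRel _

instance : IsStrictOrderedRing S.M :=
  have : ∀ a b c : S.M, a < b → a + c < b + c := hPA.out.add_lt_add
  have hadd : IsOrderedCancelAddMonoid S.M :=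
    { add_le_add_left := fun a b h c => by
        rcases h.eq_or_lt with rfl | h
        exacts [le_rfl, (this a b c h).le]
      le_of_add_le_add_left := fun a b c h => by
        by_contra! h'
        rw [add_comm a b, add_comm a c] at h
        exact (this c b a h').not_ge h }
  have : Nontrivial S.M := ⟨0, 1, (show (0 : S.M) < 1 from hPA.out.zero_lt_one).ne⟩
  { hadd with
    zero_le_one := (show (0 : S.M) < 1 from hPA.out.zero_lt_one).le
    mul_lt_mul_of_pos_left := fun a ha b c h => by
      rw [mul_comm a b, mul_comm a c]; exact hPA.out.mul_lt_mul b c a h ha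
    mul_lt_mul_of_pos_right := fun a ha b c h => hPA.out.mul_lt_mul b c a h ha }

instance : CanonicallyOrderedAdd S.M where
  exists_add_of_le {a b} h := by
    rcases h.eq_or_lt with rfl | h
    · exact ⟨0, (add_zero _).symm⟩
    · obtain ⟨c, hc⟩ := hPA.out.sub a b h
      exact ⟨c, hc.symm⟩
  le_add_self a b := by
    have h : (0 : S.M) ≤ b := (hPA.out.zero_le b).imp Eq.symm _root_.id
    simpa using add_le_add_left h a
  le_self_add a b := by
    have h : (0 : S.M) ≤ b := (hPA.out.zero_le b).imp Eq.symm _root_.id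
    simpa using add_le_add_right h a

theorem add_one_le_iff_lt {a b : S.M} : a + 1 ≤ b ↔ a < b :=
  ⟨fun h => (lt_add_one a).trans_le h, fun h => hPA.out.discrete a b h⟩

theorem lt_add_one_iff_le {a b : S.M} : a < b + 1 ↔ a ≤ b := by
  rw [← not_le, add_one_le_iff_lt, not_lt]

theorem eq_zero_or_eq_add_one (a : S.M) : a = 0 ∨ ∃ b, a = b + 1 := by
  rcases hPA.out.zero_le a with h | h
  · exact .inl h
  · obtain ⟨b, hb⟩ := hPA.out.pred a h
    exact .inr ⟨b, hb.symm⟩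

theorem dvd_of_dvd_add {u x y : S.M} (h : u ∣ x + y) (hx : u ∣ x) : u ∣ y := by
  obtain ⟨a, rfl⟩ := hx
  obtain ⟨b, hb⟩ := h
  rcases le_total a b with hab | hab
  · obtain ⟨e, rfl⟩ := exists_add_of_le hab
    rw [mul_add] at hb
    exact ⟨e, add_left_cancel hb⟩
  · have h' : u * b ≤ u * a := mul_le_mul_right hab u
    rw [← hb] at h'
    have : y = 0 := by
      have : u * a + y ≤ u * a + 0 := by rwa [add_zero]
      exact le_antisymm (le_of_add_le_add_left this) zero_le
    rw [this]
    exact dvd_zero u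

/-- The moduli `1 + (y + 1) d` are pairwise coprime when `d` is divisible by
the differences of the indices. -/
theorem dvd_of_dvd_modulus_mul {d y y' e c : S.M} (he : y = y' + e ∨ y' = y + e) (hd : e ∣ d)
    (h : 1 + (y + 1) * d ∣ (1 + (y' + 1) * d) * c) : 1 + (y + 1) * d ∣ c := by
  have key : 1 + (y + 1) * d ∣ e * (d * c) := by
    rcases he with rfl | rfl
    · refine dvd_of_dvd_add (x := (1 + (y' + 1) * d) * c) ?_ h
      exact ⟨c, by ring⟩
    · refine dvd_of_dvd_add (x := (1 + (y + 1) * d) * c) ?_ ⟨c, rfl⟩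
      convert h using 1
      ring
  have step : ∀ z, 1 + (y + 1) * d ∣ d * z → 1 + (y + 1) * d ∣ z := fun z hz => by
    refine dvd_of_dvd_add (x := (y + 1) * (d * z)) ?_ (hz.mul_left _)
    exact ⟨z, by ring⟩
  refine step _ (step _ ?_)
  obtain ⟨f, hf⟩ := hd
  have : d * (d * c) = f * (e * (d * c)) := by
    nth_rewrite 1 [hf]
    ring
  rw [this]
  exact key.mul_left f

end Arithmetic

/-! ### The semantic induction and weak regularity principles -/

section Principles

variable {S : Str} {k : ℕ}

/-- Induction for `Σₖ` predicates with parameters. -/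
def SigmaInd (S : Str) (k : ℕ) : Prop :=
  ∀ P : S.M → Prop, SigmaRel S k (fun v => P (v 0)) → P S.zero →
    (∀ m, P m → P (S.add m S.one)) → ∀ m, P m

theorem sigmaInd_of_indFor (h : IndFor S (IsSigma k)) : SigmaInd S k := by
  intro P hP h0 hs m
  obtain ⟨φ, p, hφ, hφP⟩ := hP.defBy.1.normal_form (substClosed_isSigma k)
  have key : ∀ m, Sat0 S (upd (withParams (vcons S.zero fun _ => S.zero) p) (argVar 0) m) φ ↔
      P m := fun m => by
    rw [withParams_vcons]; exact (hφP _).symm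
  simp only [← key] at h0 hs ⊢
  exact h φ hφ _ _ h0 hs m

theorem SigmaInd.mono {j : ℕ} (hjk : j ≤ k) (I : SigmaInd S k) : SigmaInd S j :=
  fun P hP => I P (hP.mono hjk)

/-- Weak regularity for conjunctions of a `Σₖ` and a `Πₖ` predicate. -/
def WeakReg (S : Str) (k : ℕ) : Prop :=
  ∀ P Q : S.M → S.M → Prop, SigmaRel S k (fun v => P (v 0) (v 1)) →
    SigmaRel S k (fun v => ¬ Q (v 0) (v 1)) → ∀ a : S.M,
    (∀ x, ∃ y, S.lt y a ∧ P x y ∧ Q x y) →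
    ∃ y, S.lt y a ∧ ∀ b, ∃ x, S.lt b x ∧ P x y ∧ Q x y

theorem WeakReg.mono {j : ℕ} (hjk : j ≤ k) (W : WeakReg S k) : WeakReg S j :=
  fun P Q hP hQ => W P Q (hP.mono hjk) (hQ.mono hjk)

theorem weakReg_of_WRFor (h : WRFor S (SigmaAndPi k)) : WeakReg S k := by
  intro P Q hP hQ a
  obtain ⟨φ, ψ, p, hφ, hψ, hφP, hψQ⟩ := hP.defBy.1.normal_form₂ (substClosed_isSigma k)
    (substClosed_isPi k) (hQ.defBy.2.congr fun _ => not_not)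
  have key : ∀ x y, Sat0 S (upd (upd (withParams (fun _ => S.zero) p) (argVar 0) x)
      (argVar 1) y) (.and φ ψ) ↔ P x y ∧ Q x y := fun x y => by
    rw [upd_withParams, upd_withParams]
    exact and_congr (hφP _).symm (hψQ _).symm
  simp only [← key]
  exact h _ ⟨φ, ψ, hφ, hψ, rfl⟩ _ _ _ (argVar_injective.ne zero_ne_one) a

end Principles

/-! ### Induction, collection and the least number principle -/

section Induction

variable {S : Str} [hPA : Fact (PAminus S)] {k : ℕ}

theorem exists_gt_gt (a b : S.M) : ∃ c, a < c ∧ b < c :=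
  ⟨max a b + 1, lt_add_one_iff_le.2 (le_max_left a b), lt_add_one_iff_le.2 (le_max_right a b)⟩

theorem SigmaRel.ex (C : BddClosed S k) {P : S.M → (ℕ → S.M) → Prop}
    (hP : SigmaRel S (k + 1) fun v => P (v 0) fun i => v (i + 1)) :
    SigmaRel S (k + 1) fun v => ∃ m, P m v := by
  choose u hu using exists_gt_gt (S := S)
  exact hP.exists_of_bddClosed C hu

theorem sigmaRel_of_isSigma_isPi {φ : Fml} (C : ∀ j < k, BddClosed S j) :
    (IsSigma k φ → ∀ g : (ℕ → S.M) → ℕ → S.M, IsPolyMap S g →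
      SigmaRel S k fun v => Sat0 S (g v) φ) ∧
    (IsPi k φ → ∀ g : (ℕ → S.M) → ℕ → S.M, IsPolyMap S g →
      SigmaRel S k fun v => ¬ Sat0 S (g v) φ) := by
  have base : ∀ {k φ}, Delta0 φ → ∀ g : (ℕ → S.M) → ℕ → S.M, IsPolyMap S g →
      SigmaRel S k (fun v => Sat0 S (g v) φ) ∧ SigmaRel S k fun v => ¬ Sat0 S (g v) φ :=
    fun {k φ} h g hg =>
      have hD : DefBy S Delta0 fun v => Sat0 S (g v) φ := ⟨φ, h, g, hg, fun _ => Iff.rfl⟩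
      ⟨hD.sigmaRel, hD.not.sigmaRel⟩
  induction k generalizing φ with
  | zero =>
    refine ⟨fun h g hg => ?_, fun h g hg => ?_⟩
    · cases h with | delta0 h => exact (base h g hg).1
    · cases h with | delta0 h => exact (base h g hg).2
  | succ k ih =>
    have ih := fun φ => @ih φ fun j hj => C j (hj.trans k.lt_succ_self)
    have C := C k k.lt_succ_self
    induction φ with
    | ex x φ ihφ =>
      refine ⟨fun h g hg => ?_, fun h g hg => ?_⟩
      · cases h with
        | delta0 h => cases h
        | ofPi h => exact ((ih _).2 h g hg).compl_succ.congr fun _ => not_not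
        | ex _ h =>
          exact SigmaRel.ex C (P := fun m v => Sat0 S (upd (g v) x m) φ)
            (ihφ.1 h _ (.upd (.var 0) (hg.comp (.drop 1)) x))
      · cases h with
        | delta0 h => cases h
        | ofSigma h => exact ((ih _).1 h g hg).compl_succ
    | all x φ ihφ =>
      refine ⟨fun h g hg => ?_, fun h g hg => ?_⟩
      · cases h with
        | delta0 h => cases h
        | ofPi h => exact ((ih _).2 h g hg).compl_succ.congr fun _ => not_not
      · cases h with
        | delta0 h => cases h
        | ofSigma h => exact ((ih _).1 h g hg).compl_succ
        | all _ h =>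
          exact (SigmaRel.ex C (P := fun m v => ¬ Sat0 S (upd (g v) x m) φ)
            (ihφ.2 h _ (.upd (.var 0) (hg.comp (.drop 1)) x))).congr
              fun v => not_forall.symm
    | _ =>
      refine ⟨fun h g hg => ?_, fun h g hg => ?_⟩
      · cases h with
        | delta0 h => exact (base h g hg).1
        | ofPi h => exact ((ih _).2 h g hg).compl_succ.congr fun _ => not_not
      · cases h with
        | delta0 h => exact (base h g hg).2
        | ofSigma h => exact ((ih _).1 h g hg).compl_succ

theorem indFor_of_sigmaInd (C : ∀ j < k, BddClosed S j) (h : SigmaInd S k) :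
    IndFor S (IsSigma k) := fun φ hφ v x =>
  h (fun m => Sat0 S (upd v x m) φ) ((sigmaRel_of_isSigma_isPi C).1 hφ _ (.upd (.var 0) (.const v) x))

theorem SigmaInd.collection (C : BddClosed S k) (I : SigmaInd S (k + 1)) {R : S.M → S.M → Prop}
    (hR : SigmaRel S k fun v => ¬ R (v 0) (v 1)) (a : S.M) (h : ∀ i < a, ∃ m, R i m) :
    ∃ b, ∀ i < a, ∃ m < b, R i m := by
  suffices ∀ c, c ≤ a → ∃ b, ∀ i < c, ∃ m < b, R i m from this a le_rfl
  suffices ∀ c, ∃ b, ∀ i < c, i < a → ∃ m < b, R i m from fun c hc =>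
    (this c).imp fun b hb i hi => hb i hi (hi.trans_le hc)
  refine I _ ?_ ⟨0, fun i hi => (not_lt_zero hi).elim⟩ ?_
  · refine .exists_compl (C.compl_ball ?_ (.var 1))
    refine SigmaRel.congr (P := fun v => v 0 < a ∧ ¬ ∃ m < v 1, R (v 0) m)
      (C.and (DefBy.lt (.var 0) (.const a)).sigmaRel
        (C.compl_bex (hR.comp₂ (R := fun i m => ¬ R i m) (.var 1) (.var 0)) (.var 1)))
      fun v => ?_
    exact Classical.not_imp.symm
  · rintro c ⟨b, hb⟩
    change ∃ b, ∀ i < c + 1, i < a → ∃ m < b, R i m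
    by_cases hc : c < a
    · obtain ⟨m, hm⟩ := h c hc
      obtain ⟨b', hbb', hmb'⟩ := exists_gt_gt b m
      refine ⟨b', fun i hi hia => ?_⟩
      rcases (lt_add_one_iff_le.1 hi).lt_or_eq with hi | rfl
      · obtain ⟨m', hm', hR'⟩ := hb i hi hia
        exact ⟨m', hm'.trans hbb', hR'⟩
      · exact ⟨m, hmb', hm⟩
    · refine ⟨b, fun i hi hia => hb i ?_ hia⟩
      exact hia.trans_le (not_lt.1 hc)

theorem BddClosed.succ (C : BddClosed S k) (I : SigmaInd S (k + 1)) : BddClosed S (k + 1) where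
  and := by
    rintro P Q ⟨R, hR, h⟩ ⟨R', hR', h'⟩
    refine SigmaRel.congr (.exists_compl (k := k)
      (P := fun b v => (∃ m, m < b ∧ R (vcons m v)) ∧ ∃ m, m < b ∧ R' (vcons m v))
      (C.compl_and (C.compl_bex (hR.comp (.vcons (.var 0) (.drop 2))) (.var 0))
        (C.compl_bex (hR'.comp (.vcons (.var 0) (.drop 2))) (.var 0)))) fun v => ?_
    rw [h, h']
    constructor
    · rintro ⟨b, ⟨m, -, hm⟩, m', -, hm'⟩
      exact ⟨⟨m, hm⟩, m', hm'⟩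
    · rintro ⟨⟨m, hm⟩, m', hm'⟩
      obtain ⟨b, hb, hb'⟩ := exists_gt_gt m m'
      exact ⟨b, ⟨m, hb, hm⟩, m', hb', hm'⟩
  or := by
    rintro P Q ⟨R, hR, h⟩ ⟨R', hR', h'⟩
    refine ⟨_, C.compl_or hR hR', fun v => ?_⟩
    exact (or_congr (h v) (h' v)).trans exists_or.symm
  ball := by
    rintro P t ⟨R, hR, h⟩ ht
    refine SigmaRel.congr (.exists_compl (k := k)
      (P := fun b v => ∀ i, i < t v → ∃ m, m < b ∧ R (vcons m (vcons i v)))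
      (C.compl_ball (C.compl_bex (hR.comp (.vcons (.var 0) (.vcons (.var 1) (.drop 3))))
        (.var 1)) (ht.comp (.drop 1)))) fun v => ?_
    constructor
    · rintro ⟨b, hb⟩ i hi
      obtain ⟨m, -, hm⟩ := hb i hi
      exact (h _).2 ⟨m, hm⟩
    · intro hv
      refine SigmaInd.collection C I (R := fun i m => R (vcons m (vcons i v)))
        (hR.comp (.vcons (.var 1) (.vcons (.var 0) (.const v)))) (t v) fun i hi => ?_
      exact (h _).1 (hv i hi)
  bex := by
    rintro P t ⟨R, hR, h⟩ ht
    refine SigmaRel.congr (.exists_compl (k := k)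
      (P := fun b v => ∃ i, i < t v ∧ ∃ m, m < b ∧ R (vcons m (vcons i v)))
      (C.compl_bex (C.compl_bex (hR.comp (.vcons (.var 0) (.vcons (.var 1) (.drop 3))))
        (.var 1)) (ht.comp (.drop 1)))) fun v => ?_
    constructor
    · rintro ⟨b, i, hi, m, -, hm⟩
      exact ⟨i, hi, (h _).2 ⟨m, hm⟩⟩
    · rintro ⟨i, hi, hP⟩
      obtain ⟨m, hm⟩ := (h _).1 hP
      exact ⟨m + 1, i, hi, m, lt_add_one m, hm⟩

theorem SigmaInd.bddClosed (I : SigmaInd S k) {j : ℕ} (hj : j ≤ k) : BddClosed S j := by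
  induction j with
  | zero => exact bddClosed_zero
  | succ j ih => exact (ih (Nat.le_of_succ_le hj)).succ (I.mono hj)

theorem SigmaInd.compl (I : SigmaInd S k) {P : S.M → Prop}
    (hP : SigmaRel S k fun v => ¬ P (v 0)) (h0 : P 0) (hs : ∀ m, P m → P (m + 1)) (a : S.M) :
    P a := by
  by_contra ha
  have C := I.bddClosed le_rfl
  have key : ∀ x, ∃ z < a + 1, z + x = a ∧ ¬ P z := by
    refine I _ ?_ ⟨a, lt_add_one a, add_zero a, ha⟩ ?_
    · exact C.bex_curried (C.and (DefBy.eq (.add (.var 0) (.var 1)) (.const a)).sigmaRel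
        (hP.comp₁ (P := fun m => ¬ P m) (.var 0))) (.const (a + 1))
    · rintro x ⟨z, hz, hzx, hPz⟩
      rcases eq_zero_or_eq_add_one z with rfl | ⟨z, rfl⟩
      · exact (hPz h0).elim
      · refine ⟨z, (lt_add_one z).trans hz, ?_, fun h => hPz (hs z h)⟩
        change z + (x + 1) = a
        rw [← hzx]
        ring
  obtain ⟨z, -, hz, -⟩ := key (a + 1)
  have : a + 1 ≤ a := le_add_self.trans_eq hz
  exact (lt_add_one a).not_ge this

theorem SigmaInd.exists_least_compl (I : SigmaInd S k) {P : S.M → Prop}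
    (hP : SigmaRel S k fun v => ¬ P (v 0)) {a : S.M} (ha : P a) :
    ∃ m, P m ∧ ∀ j < m, ¬ P j := by
  by_contra! hcon
  have : ∀ m, ∀ j < m, ¬ P j := by
    refine I _ ?_ (fun j hj => (not_lt_zero hj).elim) ?_
    · exact (I.bddClosed le_rfl).ball_curried (hP.comp₁ (P := fun m => ¬ P m) (.var 0)) (.var 0)
    · intro m hm j hj hPj
      rcases (lt_add_one_iff_le.1 hj).lt_or_eq with hj | rfl
      · exact hm j hj hPj
      · obtain ⟨i, hi, hPi⟩ := hcon j hPj
        exact hm i hi hPi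
  exact this (a + 1) a (lt_add_one a) ha

theorem SigmaInd.exists_least (I : SigmaInd S k) {P : S.M → Prop}
    (hP : SigmaRel S k fun v => P (v 0)) {a : S.M} (ha : P a) :
    ∃ m, P m ∧ ∀ j < m, ¬ P j := by
  by_contra! hcon
  have : ∀ m, ∀ j < m, ¬ P j := by
    refine I.compl ?_ (fun j hj => (not_lt_zero hj).elim) ?_
    · exact (I.bddClosed le_rfl).compl_ball (P := fun j _ => ¬ P j)
        (hP.comp₁ (P := fun m => P m) (.var 0)).compl_compl (.var 0)
    · intro m hm j hj hPj
      rcases (lt_add_one_iff_le.1 hj).lt_or_eq with hj | rfl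
      · exact hm j hj hPj
      · obtain ⟨i, hi, hPi⟩ := hcon j hPj
        exact hm i hi hPi
  exact this (a + 1) a (lt_add_one a) ha

end Induction

/-! ### Weak regularity -/

section WeakRegularity

variable {S : Str} [hPA : Fact (PAminus S)] {k : ℕ}

theorem WRFor_of_weakReg (C : ∀ j < k, BddClosed S j) (W : WeakReg S k) :
    WRFor S (SigmaAndPi k) := by
  rintro _ ⟨φ, ψ, hφ, hψ, rfl⟩ v x y - a
  have hg : IsPolyMap S fun e => upd (upd v x (e 0)) y (e 1) :=
    .upd (.var 1) (.upd (.var 0) (.const v) x) y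
  exact W (fun m i => Sat0 S (upd (upd v x m) y i) φ) (fun m i => Sat0 S (upd (upd v x m) y i) ψ)
    ((sigmaRel_of_isSigma_isPi C).1 hφ _ hg) ((sigmaRel_of_isSigma_isPi C).2 hψ _ hg) a

theorem WeakReg.sigmaInd_succ (I : SigmaInd S k) (W : WeakReg S k) : SigmaInd S (k + 1) := by
  rintro P ⟨R, hR, hPR⟩ h0 hs a
  have C := I.bddClosed le_rfl
  let q : S.M → S.M → Prop := fun y u => R (vcons u (vcons y fun _ => S.zero))
  have hq : SigmaRel S k fun v => ¬ q (v 0) (v 1) :=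
    hR.comp (.vcons (.var 1) (.vcons (.var 0) (.const _)))
  have hPq : ∀ y, P y ↔ ∃ u, q y u := fun y => hPR (vcons y fun _ => S.zero)
  by_contra ha
  have hA : SigmaRel S k fun v => ∀ u < v 0, ¬ q (v 1) u :=
    C.ball_curried (hq.comp₂ (R := fun y u => ¬ q y u) (.var 2) (.var 0)) (.var 0)
  obtain ⟨y, hya, hy⟩ := W (fun s y => ∀ u < s, ¬ q y u) (fun s y => ∀ y' < y, ∃ u < s, q y' u)
    hA (C.compl_ball (C.compl_bex (hq.comp₂ (R := fun y u => ¬ q y u) (.var 1) (.var 0))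
      (.var 1)) (.var 1)) (a + 1) fun s => by
    obtain ⟨y, hy, hmin⟩ := I.exists_least (P := fun y => ∀ u < s, ¬ q y u)
      (hA.comp₂ (R := fun s y => ∀ u < s, ¬ q y u) (.const s) (.var 0))
      (a := a) fun u _ hu => ha ((hPq a).2 ⟨u, hu⟩)
    refine ⟨y, lt_add_one_iff_le.2 ?_, hy, fun y' hy' => ?_⟩
    · by_contra! hay
      exact hmin a hay fun u _ hu => ha ((hPq a).2 ⟨u, hu⟩)
    · simpa using hmin y' hy'
  have hPy : ¬ P y := fun hP => by
    obtain ⟨u, hu⟩ := (hPq y).1 hP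
    obtain ⟨s, hs, hn, -⟩ := hy u
    exact hn u hs hu
  rcases eq_zero_or_eq_add_one y with rfl | ⟨z, rfl⟩
  · exact hPy h0
  · obtain ⟨s, -, -, hz⟩ := hy 0
    obtain ⟨u, -, hu⟩ := hz z (lt_add_one z)
    exact hPy (hs z ((hPq z).2 ⟨u, hu⟩))

theorem WeakReg.sigmaInd (h0 : SigmaInd S 0) (W : WeakReg S k) : SigmaInd S (k + 1) := by
  induction k with
  | zero => exact W.sigmaInd_succ h0
  | succ k ih => exact W.sigmaInd_succ (ih (W.mono k.le_succ))

theorem SigmaRel.dvd {s t : (ℕ → S.M) → S.M} (hs : IsPoly S s) (ht : IsPoly S t) :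
    SigmaRel S k fun v => s v ∣ t v := by
  refine SigmaRel.mono (Nat.zero_le k) (SigmaRel.congr (P := fun v => ∃ m < t v + 1, t v = s v * m)
    (bddClosed_zero.bex_curried (P := fun m v => t v = S.mul (s v) m)
      (DefBy.eq (ht.comp (.drop 1)) (.mul (hs.comp (.drop 1)) (.var 0)))
      (.add ht (.const S.one))) fun v => ⟨fun ⟨m, _, h⟩ => ⟨m, h⟩, fun ⟨m, h⟩ => ?_⟩)
  rcases eq_zero_or_eq_add_one (s v) with hsv | ⟨w, hw⟩
  · exact ⟨0, lt_add_one_iff_le.2 zero_le, by simp [h, hsv]⟩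
  · refine ⟨m, lt_add_one_iff_le.2 ?_, h⟩
    rw [h, hw, add_mul, one_mul]
    exact le_add_self

theorem SigmaInd.exists_common_multiple (I : SigmaInd S 1) {g : S.M → S.M}
    (hg : IsPoly S fun v => g (v 0)) (hpos : ∀ y, 0 < g y) (a : S.M) :
    ∃ c, 0 < c ∧ ∀ y < a, g y ∣ c := by
  revert a
  refine I _ ?_ ⟨1, zero_lt_one, fun y hy => (not_lt_zero hy).elim⟩ ?_
  · have C := bddClosed_zero (S := S)
    exact .exists_compl (C.compl_and (DefBy.not (DefBy.lt (.const S.zero) (.var 0)))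
      (C.compl_ball (DefBy.not (SigmaRel.dvd (k := 0) hg (.var 1)))
        (.var 1)))
  · rintro a ⟨c, hc, h⟩
    refine ⟨c * g a, mul_pos hc (hpos a), fun y hy => ?_⟩
    rcases (lt_add_one_iff_le.1 hy).lt_or_eq with hy | rfl
    · exact (h y hy).mul_right _
    · exact dvd_mul_left _ _

theorem SigmaInd.exists_moduli (I : SigmaInd S 1) (a : S.M) :
    ∃ d, 0 < d ∧ (∀ y < a, ∀ y' < a, ∀ c, y ≠ y' →
        1 + (y + 1) * d ∣ (1 + (y' + 1) * d) * c → 1 + (y + 1) * d ∣ c) ∧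
      ∃ c, 0 < c ∧ ∀ y < a, 1 + (y + 1) * d ∣ c := by
  obtain ⟨d, hd, hda⟩ := I.exists_common_multiple (g := fun i => i + 1)
    (.add (.var 0) (.const S.one)) (fun y => lt_add_one_iff_le.2 zero_le) a
  have hdiff : ∀ y < a, ∀ y' < y, ∃ e, y = y' + e ∧ e ∣ d := fun y hy y' hy' => by
    obtain ⟨e, rfl⟩ := exists_add_of_le hy'.le
    refine ⟨e, rfl, ?_⟩
    rcases eq_zero_or_eq_add_one e with rfl | ⟨i, rfl⟩
    · simp at hy'
    · refine hda i ((lt_add_one i).trans_le (le_trans ?_ hy.le))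
      exact le_add_self
  refine ⟨d, hd, fun y hy y' hy' c hne h => ?_, ?_⟩
  · rcases hne.lt_or_gt with hlt | hlt
    · obtain ⟨e, he, hed⟩ := hdiff y' hy' y hlt
      exact dvd_of_dvd_modulus_mul (.inr he) hed h
    · obtain ⟨e, he, hed⟩ := hdiff y hy y' hlt
      exact dvd_of_dvd_modulus_mul (.inl he) hed h
  · exact I.exists_common_multiple (g := fun y => 1 + (y + 1) * d)
      (.add (.const S.one) (.mul (.add (.var 0) (.const S.one)) (.const d)))
      (fun y => lt_of_lt_of_le zero_lt_one le_self_add) a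

theorem SigmaInd.weakReg (I : SigmaInd S (k + 2)) : WeakReg S (k + 1) := by
  intro P Q hP hQ a hx
  by_contra! hcon
  have C := I.bddClosed (j := k + 1) (Nat.le_succ _)
  have C' := I.bddClosed (j := k) (by omega)
  obtain ⟨d, hd, hcop, c₀, hc₀, hdvd⟩ := SigmaInd.exists_moduli (I.mono (by omega)) a
  set u : S.M → S.M := fun y => 1 + (y + 1) * d with hu
  have hu_poly : ∀ {s : (ℕ → S.M) → S.M}, IsPoly S s → IsPoly S fun v => u (s v) := fun hs =>
    .add (.const S.one) (.mul (.add hs (.const S.one)) (.const d))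
  have hu_gt : ∀ y, 1 < u y := fun y => by
    have : 0 < (y + 1) * d := mul_pos (lt_add_one_iff_le.2 zero_le) hd
    exact lt_add_of_pos_right 1 this
  -- `A c x` says that `Q x y` fails for all `y < a` outside the set coded by `c`.
  let A : S.M → S.M → Prop := fun c x => ∀ y < a, ¬ u y ∣ c → ¬ Q x y
  have hA : SigmaRel S (k + 1) fun v => A (v 0) (v 1) := by
    refine C.ball_curried (P := fun y v => ¬ u y ∣ v 0 → ¬ Q (v 1) y) ?_ (.const a)
    refine SigmaRel.congr (C.or (.dvd (hu_poly (.var 0)) (.var 1))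
      (hQ.comp₂ (R := fun x y => ¬ Q x y) (.var 2) (.var 0))) fun v => ?_
    exact or_iff_not_imp_left
  have hB : SigmaRel S (k + 2) fun v => ¬ (0 < v 0 ∧ ∀ b, ∃ x, b < x ∧ A (v 0) x) := by
    refine SigmaRel.congr (.exists_compl (k := k + 1)
      (P := fun b v => ¬ (0 < v 0 ∧ ∃ x, b < x ∧ A (v 0) x)) (SigmaRel.compl_compl
        (C.and (DefBy.lt (.const S.zero) (.var 1)).sigmaRel
          (SigmaRel.ex C' (C.and (DefBy.lt (.var 1) (.var 0)).sigmaRel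
            (hA.comp₂ (.var 2) (.var 0))))))) fun v => ?_
    rw [← not_forall, forall_and]
    simp
  obtain ⟨c, ⟨hc, hcA⟩, hmin⟩ := I.exists_least_compl
    (P := fun c => 0 < c ∧ ∀ b, ∃ x, b < x ∧ A c x) hB (a := c₀)
    ⟨hc₀, fun b => ⟨b + 1, lt_add_one b, fun y hy hn => (hn (hdvd y hy)).elim⟩⟩
  have hbound : ∀ y < a, ∃ b, u y ∣ c → ∀ x, b < x → A c x → ¬ P x y := by
    intro y hy
    by_cases hyc : u y ∣ c
    · obtain ⟨c', rfl⟩ := hyc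
      have hc' : 0 < c' := pos_of_mul_pos_right hc zero_le
      have hlt : c' < u y * c' := lt_mul_of_one_lt_left hc' (hu_gt y)
      have := hmin c' hlt
      push Not at this
      obtain ⟨b₁, hb₁⟩ := this hc'
      obtain ⟨b₂, hb₂⟩ := hcon y hy
      obtain ⟨b, h₁, h₂⟩ := exists_gt_gt b₁ b₂
      refine ⟨b, fun _ x hbx hAx hPx => hb₁ x (h₁.trans hbx) fun y' hy' hn hQ' => ?_⟩
      by_cases hyy : y' = y
      · subst hyy
        exact hb₂ x (h₂.trans hbx) hPx hQ'
      · exact hAx y' hy' (fun h => hn (hcop y' hy' y hy c' hyy h)) hQ'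
    · exact ⟨0, fun h => (hyc h).elim⟩
  obtain ⟨b, hb⟩ := SigmaInd.collection C I
    (R := fun y b => u y ∣ c → ∀ x, b < x → A c x → ¬ P x y) (by
      refine SigmaRel.congr (C.and (SigmaRel.dvd (hu_poly (.var 0)) (.const c))
        (SigmaRel.ex C' (P := fun x v => v 1 < x ∧ A c x ∧ P x (v 0))
          (C.and (DefBy.lt (.var 2) (.var 0)).sigmaRel
          (C.and (hA.comp₂ (.const c) (.var 0)) (hP.comp₂ (.var 0) (.var 1)))))) fun v => ?_
      push Not
      rfl) a hbound
  obtain ⟨x, hbx, hAx⟩ := hcA b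
  obtain ⟨y, hy, hPx, hQx⟩ := hx x
  obtain ⟨b', hb', hyb⟩ := hb y hy
  exact hyb (by_contra fun h => hAx y hy h hQx) x (hb'.trans hbx) hAx hPx

end WeakRegularity

/-- Theorem `thm:rdwedge<->ind`.
For each `n ∈ ℕ`, the theories `WR(Σₙ₊₁ ∧ Πₙ₊₁)` and `IΣₙ₊₂` are
equivalent: a model of `IΔ₀` satisfies the weak regularity principle for
all conjunctions of a `Σₙ₊₁` and a `Πₙ₊₁` formula iff it satisfies
`Σₙ₊₂`-induction. -/
theorem statement_18 (n : ℕ) (S : Str) (h : IDelta0 S) :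
    WRFor S (SigmaAndPi (n + 1)) ↔ ISigma S (n + 2) := by
  have : Fact (PAminus S) := ⟨h.1⟩
  constructor
  · intro W
    have h0 : SigmaInd S 0 := sigmaInd_of_indFor fun φ hφ => by
      cases hφ with | delta0 hφ => exact h.2 φ hφ
    have I := (weakReg_of_WRFor W).sigmaInd h0
    exact ⟨h.1, indFor_of_sigmaInd (fun j hj => I.bddClosed hj.le) I⟩
  · intro I
    have I := sigmaInd_of_indFor I.2
    exact WRFor_of_weakReg (fun j hj => I.bddClosed (by omega)) I.weakReg

end PaperArith
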